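/- arXiv:2012.02656 — 2 statements merged into one kernel-verified Lean document; each statement's English description precedes it below -/
import Mathlib

section
/- For every integer d ≥ 0 there exists a constant C₂ > 0 such that for every integer b with 0 ≤ b ≤ d and every p ∈ ℕ, Σ_{k₀+k₁+⋯+k_b = p} ∏_{j=0}^{b} ((k_j−2)⁺)! / (k_j)! ≤ C₂ (8π²(d+1))^{b+1} / (p+1)², where the sum ranges over all (b+1)-tuples (k₀,…,k_b) of non-negative integers summing to p. -/
open Finset

theorem Finset.Nat.sum_antidiagonalTuple_succ {M : Type*} [AddCommMonoid M] (k n : ℕ)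
    (g : (Fin (k + 1) → ℕ) → M) :
    ∑ K ∈ Finset.Nat.antidiagonalTuple (k + 1) n, g K =
      ∑ ij ∈ antidiagonal n, ∑ K ∈ Finset.Nat.antidiagonalTuple k ij.2, g (Fin.cons ij.1 K) := by
  rw [Finset.sum_sigma']
  refine Finset.sum_bij' (fun K _ => ⟨(K 0, ∑ i, Fin.tail K i), Fin.tail K⟩)
    (fun x _ => Fin.cons x.1.1 x.2) ?_ ?_ ?_ ?_ ?_
  · intro K hK
    rw [Finset.Nat.mem_antidiagonalTuple, Fin.sum_univ_succ] at hK
    simpa [Finset.Nat.mem_antidiagonalTuple, Fin.tail] using hK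
  · rintro ⟨⟨i, j⟩, K⟩ h
    simp only [mem_sigma, HasAntidiagonal.mem_antidiagonal, Finset.Nat.mem_antidiagonalTuple] at h
    simp [Finset.Nat.mem_antidiagonalTuple, Fin.sum_univ_succ, h.1, h.2]
  · intro K _
    simp
  · rintro ⟨⟨i, j⟩, K⟩ h
    simp only [mem_sigma, HasAntidiagonal.mem_antidiagonal, Finset.Nat.mem_antidiagonalTuple] at h
    simp [h.2]
  · intro K _
    simp

theorem factorial_sub_two_div_factorial_le (k : ℕ) :
    ((k - 2).factorial : ℝ) / (k.factorial : ℝ) ≤ 6 / ((k : ℝ) + 1) ^ 2 := by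
  match k with
  | 0 => norm_num
  | 1 => norm_num
  | k + 2 =>
    have hk : (0 : ℝ) < k.factorial := by positivity
    rw [div_le_div_iff₀ (by positivity) (by positivity)]
    simp only [Nat.add_sub_cancel, Nat.factorial_succ]
    push_cast
    have h : ((k : ℝ) + 2 + 1) ^ 2 ≤ 6 * ((k + 1 + 1) * (k + 1)) := by
      nlinarith [Nat.cast_nonneg (α := ℝ) k]
    nlinarith [mul_le_mul_of_nonneg_left h hk.le]

theorem sum_range_inv_succ_sq_le (n : ℕ) :
    ∑ i ∈ range (n + 1), (1 : ℝ) / ((i : ℝ) + 1) ^ 2 ≤ 2 - 1 / ((n : ℝ) + 1) := by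
  induction n with
  | zero => norm_num
  | succ n ih =>
    rw [sum_range_succ]
    have h : (1 : ℝ) / ((n + 1 : ℕ) + 1 : ℝ) ^ 2 ≤
        1 / ((n : ℝ) + 1) - 1 / ((n + 1 : ℕ) + 1 : ℝ) := by
      push_cast
      rw [div_sub_div _ _ (by positivity) (by positivity),
        div_le_div_iff₀ (by positivity) (by positivity)]
      nlinarith [Nat.cast_nonneg (α := ℝ) n]
    linarith

/-- The sequence `1 / (n + 1) ^ 2` is, up to a constant, stable under convolution. -/
theorem sum_antidiagonal_inv_sq_mul_inv_sq_le (p : ℕ) :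
    ∑ ij ∈ antidiagonal p, (1 : ℝ) / ((ij.1 : ℝ) + 1) ^ 2 * (1 / ((ij.2 : ℝ) + 1) ^ 2) ≤
      8 / ((p : ℝ) + 1) ^ 2 := by
  have hsum : ∑ ij ∈ antidiagonal p, (1 : ℝ) / ((ij.1 : ℝ) + 1) ^ 2 ≤ 2 := by
    rw [Finset.Nat.sum_antidiagonal_eq_sum_range_succ_mk]
    refine (sum_range_inv_succ_sq_le p).trans ?_
    have : (0 : ℝ) ≤ 1 / ((p : ℝ) + 1) := by positivity
    linarith
  have hswap : ∑ ij ∈ antidiagonal p, (1 : ℝ) / ((ij.2 : ℝ) + 1) ^ 2 =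
      ∑ ij ∈ antidiagonal p, (1 : ℝ) / ((ij.1 : ℝ) + 1) ^ 2 :=
    Finset.Nat.sum_antidiagonal_swap (f := fun ij : ℕ × ℕ => (1 : ℝ) / ((ij.1 : ℝ) + 1) ^ 2)
  have hterm : ∀ ij ∈ antidiagonal p,
      (1 : ℝ) / ((ij.1 : ℝ) + 1) ^ 2 * (1 / ((ij.2 : ℝ) + 1) ^ 2) ≤
        2 / ((p : ℝ) + 1) ^ 2 * (1 / ((ij.1 : ℝ) + 1) ^ 2 + 1 / ((ij.2 : ℝ) + 1) ^ 2) := by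
    rintro ⟨i, j⟩ h
    obtain rfl := HasAntidiagonal.mem_antidiagonal.mp h
    push_cast
    have hi : (0 : ℝ) ≤ i := Nat.cast_nonneg i
    have hj : (0 : ℝ) ≤ j := Nat.cast_nonneg j
    rw [div_add_div _ _ (by positivity) (by positivity), div_mul_div_comm, div_mul_div_comm,
      div_le_div_iff₀ (by positivity) (by positivity)]
    have key : ((i : ℝ) + j + 1) ^ 2 ≤ 2 * (((j : ℝ) + 1) ^ 2 + ((i : ℝ) + 1) ^ 2) := by
      nlinarith [sq_nonneg ((i : ℝ) - j)]
    have hpos : (0 : ℝ) ≤ ((i : ℝ) + 1) ^ 2 * ((j : ℝ) + 1) ^ 2 := by positivity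
    nlinarith [mul_le_mul_of_nonneg_right key hpos]
  calc _ ≤ _ := sum_le_sum hterm
    _ = 2 / ((p : ℝ) + 1) ^ 2 *
        (∑ ij ∈ antidiagonal p, (1 : ℝ) / ((ij.1 : ℝ) + 1) ^ 2 +
          ∑ ij ∈ antidiagonal p, (1 : ℝ) / ((ij.2 : ℝ) + 1) ^ 2) := by
      rw [← mul_sum, sum_add_distrib]
    _ ≤ 2 / ((p : ℝ) + 1) ^ 2 * 4 := by
      rw [hswap]
      gcongr
      linarith
    _ = 8 / ((p : ℝ) + 1) ^ 2 := by ring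

theorem sum_antidiagonalTuple_prod_factorial_le (b p : ℕ) :
    ∑ K ∈ Finset.Nat.antidiagonalTuple (b + 1) p,
        ∏ j : Fin (b + 1), (((K j - 2).factorial : ℝ) / ((K j).factorial : ℝ)) ≤
      48 ^ (b + 1) / ((p : ℝ) + 1) ^ 2 := by
  induction b generalizing p with
  | zero =>
    rw [zero_add, Finset.Nat.antidiagonalTuple_one, sum_singleton]
    simp only [Finset.univ_unique, prod_singleton, Matrix.cons_val_fin_one, pow_one]
    refine (factorial_sub_two_div_factorial_le p).trans ?_
    gcongr
    norm_num
  | succ b ih =>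
    rw [Finset.Nat.sum_antidiagonalTuple_succ]
    simp_rw [Fin.prod_univ_succ (n := b + 1), Fin.cons_zero, Fin.cons_succ, ← mul_sum]
    calc _ ≤ ∑ ij ∈ antidiagonal p,
          6 / ((ij.1 : ℝ) + 1) ^ 2 * (48 ^ (b + 1) / ((ij.2 : ℝ) + 1) ^ 2) := by
          refine sum_le_sum fun ij _ => mul_le_mul (factorial_sub_two_div_factorial_le _) (ih _)
            (sum_nonneg fun _ _ => prod_nonneg fun _ _ => by positivity) (by positivity)
      _ = 6 * 48 ^ (b + 1) * ∑ ij ∈ antidiagonal p,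
          (1 : ℝ) / ((ij.1 : ℝ) + 1) ^ 2 * (1 / ((ij.2 : ℝ) + 1) ^ 2) := by
          rw [mul_sum]
          exact sum_congr rfl fun _ _ => by ring
      _ ≤ 6 * 48 ^ (b + 1) * (8 / ((p : ℝ) + 1) ^ 2) := by
          gcongr
          exact sum_antidiagonal_inv_sq_mul_inv_sq_le p
      _ = 48 ^ (b + 1 + 1) / ((p : ℝ) + 1) ^ 2 := by ring

/-- the combinatorial inequality \eqref{cl1} from the proof of the
polynomial-composition lemma: for every `d` there is `C₂ > 0` such that for all
`0 ≤ b ≤ d` and all `p`,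
`∑_{k₀+⋯+k_b = p} ∏_j ((k_j−2)⁺)!/(k_j)! ≤ C₂ (8π²(d+1))^{b+1}/(p+1)²`.
(Here `(a)⁺` is truncated subtraction `k_j - 2` in `ℕ`.) -/
theorem factorial_convolution_bound (d : ℕ) :
    ∃ C₂ > 0, ∀ b ≤ d, ∀ p : ℕ,
      ∑ K ∈ Finset.Nat.antidiagonalTuple (b+1) p,
          ∏ j : Fin (b+1), (((K j - 2).factorial : ℝ) / ((K j).factorial : ℝ))
        ≤ C₂ * (8 * Real.pi ^ 2 * (d+1)) ^ (b+1) / ((p : ℝ) + 1) ^ 2 := by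
  refine ⟨1, one_pos, fun b _ p => (sum_antidiagonalTuple_prod_factorial_le b p).trans ?_⟩
  have hd : (0 : ℝ) ≤ d := Nat.cast_nonneg d
  have hpi : (9 : ℝ) ≤ Real.pi ^ 2 := by nlinarith [Real.pi_gt_three]
  rw [one_mul]
  gcongr
  nlinarith [mul_nonneg (sq_nonneg Real.pi) hd]
end

section
/- Let n ≥ 2, let u ∈ C_c^∞(closure of ℝⁿ₊) and set g(x') = u(x',0) and f = ∂²_n u + x_n Δ_{x'} u. Then ∫_{ℝⁿ₊} ( (∂²_n u)² + x_n² |D²_{x'} u|² + 2 x_n |∇_{x'} ∂_n u|² ) dx = ∫_{ℝⁿ₊} f² dx + ∫_{ℝⁿ⁻¹} |∇_{x'} g|² dx', where |D²_{x'}u|² = Σ_{i,j=1}^{n−1} (∂_{ij}u)². -/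
noncomputable section
open MeasureTheory Finset

/-- Partial derivative in direction `i`. -/
def pd {d : ℕ} (i : Fin d) (f : (Fin d → ℝ) → ℝ) : (Fin d → ℝ) → ℝ :=
  fun x => fderiv ℝ f x (Pi.single i 1)

section PartialDerivatives

variable {d : ℕ} {f g : (Fin d → ℝ) → ℝ}

theorem ContDiff.pd (hf : ContDiff ℝ (⊤ : ℕ∞) f) (i : Fin d) : ContDiff ℝ (⊤ : ℕ∞) (pd i f) :=
  (hf.fderiv_right (by simp)).clm_apply contDiff_const

theorem HasCompactSupport.pd (hf : HasCompactSupport f) (i : Fin d) : HasCompactSupport (pd i f) :=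
  hf.fderiv_apply ℝ _

theorem pd_comm (hf : ContDiff ℝ (⊤ : ℕ∞) f) (i j : Fin d) : pd i (pd j f) = pd j (pd i f) := by
  have hd : Differentiable ℝ (fderiv ℝ f) :=
    (hf.fderiv_right (m := (⊤ : ℕ∞)) (by simp)).differentiable (by simp)
  have key : ∀ (k l : Fin d) (x : Fin d → ℝ),
      pd k (pd l f) x = fderiv ℝ (fderiv ℝ f) x (Pi.single k 1) (Pi.single l 1) := by
    intro k l x
    have := ((hd x).hasFDerivAt.clm_apply
      (hasFDerivAt_const (Pi.single l (1 : ℝ) : Fin d → ℝ) x)).fderiv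
    change fderiv ℝ (fun y => fderiv ℝ f y (Pi.single l 1)) x (Pi.single k 1) = _
    rw [this]
    simp
  ext x
  rw [key, key]
  exact (hf.contDiffAt (x := x)).isSymmSndFDerivAt
    (by rw [minSmoothness_of_isRCLikeNormedField]; exact WithTop.coe_le_coe.2 (le_top : (2 : ℕ∞) ≤ ⊤)) _ _

theorem pd_mul (hf : ContDiff ℝ (⊤ : ℕ∞) f) (hg : ContDiff ℝ (⊤ : ℕ∞) g) (i : Fin d)
    (x : Fin d → ℝ) : pd i (fun y => f y * g y) x = pd i f x * g x + f x * pd i g x := by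
  unfold pd
  rw [fderiv_fun_mul (hf.differentiable (by simp) x) (hg.differentiable (by simp) x)]
  simp
  ring

theorem pd_weight_mul_mul {w : (Fin d → ℝ) → ℝ} (hw : ContDiff ℝ (⊤ : ℕ∞) w)
    (hf : ContDiff ℝ (⊤ : ℕ∞) f) (hg : ContDiff ℝ (⊤ : ℕ∞) g) (i : Fin d) (x : Fin d → ℝ) :
    pd i (fun y => w y * (f y * g y)) x
      = pd i w x * (f x * g x) + w x * (pd i f x * g x + f x * pd i g x) := by
  rw [pd_mul hw (hf.mul hg), pd_mul hf hg]

theorem pd_coord (i j : Fin d) (x : Fin d → ℝ) :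
    pd i (fun y => y j) x = (Pi.single i 1 : Fin d → ℝ) j := by
  unfold pd
  rw [(hasFDerivAt_apply j x).fderiv]
  simp

theorem integrable_pd (hf : ContDiff ℝ (⊤ : ℕ∞) f) (hc : HasCompactSupport f) (i : Fin d) :
    Integrable (pd i f) :=
  (hf.pd i).continuous.integrable_of_hasCompactSupport (hc.pd i)

end PartialDerivatives

section HalfSpace

variable {n : ℕ}

theorem measurableSet_halfSpace : MeasurableSet {x : Fin (n + 1) → ℝ | 0 < x (Fin.last n)} :=
  measurableSet_lt measurable_const (measurable_pi_apply _)

theorem setIntegral_halfSpace_pd_castSucc {F : (Fin (n + 1) → ℝ) → ℝ}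
    (hF : ContDiff ℝ (⊤ : ℕ∞) F) (hc : HasCompactSupport F) (i : Fin n) :
    ∫ x in {x : Fin (n + 1) → ℝ | 0 < x (Fin.last n)}, pd (Fin.castSucc i) F x = 0 := by
  set H := {x : Fin (n + 1) → ℝ | 0 < x (Fin.last n)} with hH
  have hHm : MeasurableSet H := measurableSet_halfSpace
  have hmul : ∀ G : (Fin (n + 1) → ℝ) → ℝ,
      (fun x => ContinuousLinearMap.mul ℝ ℝ (H.indicator 1 x) (G x)) = H.indicator G := by
    intro G
    ext x
    by_cases hx : x ∈ H <;> simp [hx]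
  have hFi : Integrable F := hF.continuous.integrable_of_hasCompactSupport hc
  have := integral_bilinear_hasLineDerivAt_right_eq_neg_left_of_integrable
    (μ := (volume : Measure (Fin (n + 1) → ℝ)))
    (B := ContinuousLinearMap.mul ℝ ℝ) (f := H.indicator 1) (f' := 0) (g := F)
    (g' := pd (Fin.castSucc i) F) (v := Pi.single (Fin.castSucc i) 1)
    (by simp) (by rw [hmul]; exact (integrable_pd hF hc _).indicator hHm)
    (by rw [hmul]; exact hFi.indicator hHm)
    (fun x _ => by
      unfold HasLineDerivAt
      have : (fun t : ℝ => H.indicator (1 : (Fin (n + 1) → ℝ) → ℝ)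
          (x + t • Pi.single (Fin.castSucc i) 1)) = fun _ => H.indicator 1 x := by
        ext t
        simp [Set.indicator, hH, Fin.castSucc_ne_last]
      rw [this]
      exact hasDerivAt_const _ _)
    (fun x _ => ((hF.differentiable (by simp) x).hasFDerivAt.hasLineDerivAt _))
  rw [← integral_indicator hHm, ← hmul, this]
  simp

theorem hasDerivAt_snoc (x : Fin n → ℝ) (t : ℝ) :
    HasDerivAt (fun s : ℝ => (Fin.snoc x s : Fin (n + 1) → ℝ)) (Pi.single (Fin.last n) 1) t := by
  rw [hasDerivAt_pi]
  intro i
  induction i using Fin.lastCases with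
  | last => simpa using hasDerivAt_id' t
  | cast i => simpa [Fin.castSucc_ne_last] using hasDerivAt_const t (x i)

theorem hasFDerivAt_snoc_zero (x : Fin n → ℝ) :
    HasFDerivAt (fun y : Fin n → ℝ => (Fin.snoc y 0 : Fin (n + 1) → ℝ))
      (ContinuousLinearMap.pi fun i => Fin.lastCases (motive := fun _ => (Fin n → ℝ) →L[ℝ] ℝ) 0
        (fun j => ContinuousLinearMap.proj j) i) x := by
  rw [hasFDerivAt_pi]
  intro i
  induction i using Fin.lastCases with
  | last => simpa using hasFDerivAt_const (0 : ℝ) x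
  | cast i => simpa using hasFDerivAt_apply i x

theorem isClosedEmbedding_snoc_left (t : ℝ) :
    Topology.IsClosedEmbedding (fun y : Fin n → ℝ => (Fin.snoc y t : Fin (n + 1) → ℝ)) :=
  Function.LeftInverse.isClosedEmbedding (f := fun y i => y (Fin.castSucc i))
    (fun y => by ext; simp) (by fun_prop)
    (continuous_pi fun i => by
      induction i using Fin.lastCases with
      | last => simpa using continuous_const
      | cast i => simpa using continuous_apply i)

theorem isClosedEmbedding_snoc_right (x : Fin n → ℝ) :
    Topology.IsClosedEmbedding (fun t : ℝ => (Fin.snoc x t : Fin (n + 1) → ℝ)) :=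
  Function.LeftInverse.isClosedEmbedding (f := fun y => y (Fin.last n))
    (fun y => by simp) (by fun_prop)
    (continuous_iff_continuousAt.2 fun t => (hasDerivAt_snoc x t).continuousAt)

theorem contDiff_snoc_right (x : Fin n → ℝ) :
    ContDiff ℝ (⊤ : ℕ∞) (fun t : ℝ => (Fin.snoc x t : Fin (n + 1) → ℝ)) :=
  contDiff_pi.2 fun i => by
    induction i using Fin.lastCases with
    | last => simpa using contDiff_fun_id
    | cast i => simpa using contDiff_const

theorem setIntegral_halfSpace_pd_last {F : (Fin (n + 1) → ℝ) → ℝ}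
    (hF : ContDiff ℝ (⊤ : ℕ∞) F) (hc : HasCompactSupport F) :
    ∫ x in {x : Fin (n + 1) → ℝ | 0 < x (Fin.last n)}, pd (Fin.last n) F x
      = -∫ x' : Fin n → ℝ, F (Fin.snoc x' 0) := by
  set H := {x : Fin (n + 1) → ℝ | 0 < x (Fin.last n)} with hH
  have hHm : MeasurableSet H := measurableSet_halfSpace
  have hmp := (volume_preserving_piFinSuccAbove (fun _ : Fin (n + 1) => ℝ) (Fin.last n)).symm
  have hInt : Integrable (H.indicator (pd (Fin.last n) F)) :=
    (integrable_pd hF hc _).indicator hHm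
  rw [← integral_indicator hHm, ← hmp.integral_comp', Measure.volume_eq_prod,
    integral_prod_symm (fun z => H.indicator (pd (Fin.last n) F)
      ((MeasurableEquiv.piFinSuccAbove (fun _ => ℝ) (Fin.last n)).symm z))
      ((hmp.integrable_comp_emb (MeasurableEquiv.measurableEmbedding _)).2 hInt),
    ← integral_neg]
  congr 1
  ext x
  have hderiv : ∀ t, deriv (fun s => F (Fin.snoc x s)) t = pd (Fin.last n) F (Fin.snoc x t) :=
    fun t => ((hF.differentiable (by simp) _).hasFDerivAt.comp_hasDerivAt t
      (hasDerivAt_snoc x t)).deriv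
  have hslice : ∫ t in Set.Ioi 0, deriv (fun s => F (Fin.snoc x s)) t = -F (Fin.snoc x 0) :=
    HasCompactSupport.integral_Ioi_deriv_eq
      ((hF.comp (contDiff_snoc_right x)).of_le (by simp))
      (hc.comp_isClosedEmbedding (isClosedEmbedding_snoc_right x)) 0
  rw [← hslice, ← integral_indicator measurableSet_Ioi]
  congr 1
  ext t
  have he : (MeasurableEquiv.piFinSuccAbove (fun _ : Fin (n + 1) => ℝ) (Fin.last n)).symm (t, x)
      = (Fin.snoc x t : Fin (n + 1) → ℝ) := by
    simp [MeasurableEquiv.piFinSuccAbove_symm_apply, Fin.insertNthEquiv]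
  rw [he]
  by_cases ht : 0 < t
  · simp [Set.indicator, hH, ht, hderiv]
  · simp [Set.indicator, hH, ht]

theorem pd_comp_snoc_zero {F : (Fin (n + 1) → ℝ) → ℝ} (hF : ContDiff ℝ (⊤ : ℕ∞) F)
    (i : Fin n) (x : Fin n → ℝ) :
    pd i (fun y => F (Fin.snoc y 0)) x = pd (Fin.castSucc i) F (Fin.snoc x 0) := by
  have := ((hF.differentiable (by simp) _).hasFDerivAt.comp x (hasFDerivAt_snoc_zero x)).fderiv
  unfold pd
  simp only [Function.comp_def] at this
  rw [this, ContinuousLinearMap.comp_apply]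
  congr 1
  ext j
  induction j using Fin.lastCases with
  | last => simp [(Fin.castSucc_ne_last i).symm]
  | cast j => simp [Pi.single_apply]

end HalfSpace

/-- the energy identity for the Grushin operator with `m = 1`:
for `u ∈ C_c^∞(closure ℝⁿ₊)`, with `f = ∂ₙ²u + xₙ Δ_{x'}u` and `g = u(·,0)`,
`∫_{ℝⁿ₊} ((∂ₙ²u)² + xₙ²|D²_{x'}u|² + 2xₙ|∇_{x'}∂ₙu|²) = ∫_{ℝⁿ₊} f² + ∫_{ℝⁿ⁻¹} |∇_{x'}g|²`.
(Ambient dimension is `n+1 ≥ 2`; tangential indices are `Fin.castSucc i`.) -/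
theorem grushin_energy_identity (n : ℕ) (hn : 1 ≤ n)
    (u : (Fin (n+1) → ℝ) → ℝ) (hu : ContDiff ℝ (⊤:ℕ∞) u) (hcs : HasCompactSupport u)
    (f : (Fin (n+1) → ℝ) → ℝ)
    (hf : ∀ x, f x = pd (Fin.last n) (pd (Fin.last n) u) x
        + x (Fin.last n) * ∑ i : Fin n, pd (Fin.castSucc i) (pd (Fin.castSucc i) u) x)
    (g : (Fin n → ℝ) → ℝ) (hg : ∀ x', g x' = u (Fin.snoc x' 0)) :
    ∫ x in {x : Fin (n+1) → ℝ | 0 < x (Fin.last n)},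
        ((pd (Fin.last n) (pd (Fin.last n) u) x) ^ 2
          + (x (Fin.last n)) ^ 2 *
              ∑ i : Fin n, ∑ j : Fin n, (pd (Fin.castSucc i) (pd (Fin.castSucc j) u) x) ^ 2
          + 2 * x (Fin.last n) *
              ∑ i : Fin n, (pd (Fin.last n) (pd (Fin.castSucc i) u) x) ^ 2)
      = (∫ x in {x : Fin (n+1) → ℝ | 0 < x (Fin.last n)}, (f x) ^ 2)
        + ∫ x' : Fin n → ℝ, ∑ i : Fin n, (pd i g x') ^ 2 := by
  set N := Fin.last n with hN
  set H := {x : Fin (n + 1) → ℝ | 0 < x N} with hH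
  have hX : ContDiff ℝ (⊤ : ℕ∞) (fun x : Fin (n + 1) → ℝ => x N) := contDiff_apply ℝ ℝ N
  have hX2 : ContDiff ℝ (⊤ : ℕ∞) (fun x : Fin (n + 1) → ℝ => x N * x N) := hX.mul hX
  have s1 : ∀ k, ContDiff ℝ (⊤ : ℕ∞) (pd k u) := fun k => hu.pd k
  have s2 : ∀ k l, ContDiff ℝ (⊤ : ℕ∞) (pd k (pd l u)) := fun k l => (s1 l).pd k
  have c1 : ∀ k, HasCompactSupport (pd k u) := fun k => hcs.pd k
  -- the tangential and normal fluxes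
  let A : Fin n → (Fin (n + 1) → ℝ) → ℝ := fun i x =>
    x N * (pd N (pd N u) x * pd (Fin.castSucc i) u x)
  let B : Fin n → Fin n → (Fin (n + 1) → ℝ) → ℝ := fun i j x =>
    x N * x N * (pd (Fin.castSucc j) (pd (Fin.castSucc j) u) x * pd (Fin.castSucc i) u x)
  let C : Fin n → Fin n → (Fin (n + 1) → ℝ) → ℝ := fun i j x =>
    x N * x N * (pd (Fin.castSucc i) (pd (Fin.castSucc j) u) x * pd (Fin.castSucc i) u x)
  let R : Fin n → (Fin (n + 1) → ℝ) → ℝ := fun i x =>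
    pd (Fin.castSucc i) u x * pd (Fin.castSucc i) u x
  let S : Fin n → (Fin (n + 1) → ℝ) → ℝ := fun i x =>
    x N * (pd N (pd (Fin.castSucc i) u) x * pd (Fin.castSucc i) u x)
  have sA : ∀ i, ContDiff ℝ (⊤ : ℕ∞) (A i) := fun i => hX.mul ((s2 _ _).mul (s1 _))
  have sB : ∀ i j, ContDiff ℝ (⊤ : ℕ∞) (B i j) := fun i j => hX2.mul ((s2 _ _).mul (s1 _))
  have sC : ∀ i j, ContDiff ℝ (⊤ : ℕ∞) (C i j) := fun i j => hX2.mul ((s2 _ _).mul (s1 _))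
  have sR : ∀ i, ContDiff ℝ (⊤ : ℕ∞) (R i) := fun i => (s1 _).mul (s1 _)
  have sS : ∀ i, ContDiff ℝ (⊤ : ℕ∞) (S i) := fun i => hX.mul ((s2 _ _).mul (s1 _))
  have cA : ∀ i, HasCompactSupport (A i) := fun i => ((c1 _).mul_left).mul_left
  have cB : ∀ i j, HasCompactSupport (B i j) := fun i j => ((c1 _).mul_left).mul_left
  have cC : ∀ i j, HasCompactSupport (C i j) := fun i j => ((c1 _).mul_left).mul_left
  have cR : ∀ i, HasCompactSupport (R i) := fun i => (c1 _).mul_left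
  have cS : ∀ i, HasCompactSupport (S i) := fun i => ((c1 _).mul_left).mul_left
  have dX : ∀ i : Fin n, ∀ x, pd (Fin.castSucc i) (fun y : Fin (n + 1) → ℝ => y N) x = 0 := by
    intro i x
    rw [pd_coord]
    exact Pi.single_eq_of_ne (Fin.castSucc_ne_last i).symm _
  have dX2 : ∀ i : Fin n, ∀ x,
      pd (Fin.castSucc i) (fun y : Fin (n + 1) → ℝ => y N * y N) x = 0 := by
    intro i x
    rw [pd_mul hX hX, dX]
    ring
  have dN : ∀ x, pd N (fun y : Fin (n + 1) → ℝ => y N) x = 1 := by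
    intro x
    rw [pd_coord]
    exact Pi.single_eq_same _ _
  let D : (Fin (n + 1) → ℝ) → ℝ := fun x =>
    ∑ i, (2 * pd (Fin.castSucc i) (A i) x
      + ∑ j, (pd (Fin.castSucc i) (B i j) x - pd (Fin.castSucc j) (C i j) x)
      + (pd N (R i) x - 2 * pd N (S i) x))
  have point : ∀ x, (pd N (pd N u) x) ^ 2
      + (x N) ^ 2 * ∑ i : Fin n, ∑ j : Fin n, (pd (Fin.castSucc i) (pd (Fin.castSucc j) u) x) ^ 2
      + 2 * x N * ∑ i : Fin n, (pd N (pd (Fin.castSucc i) u) x) ^ 2 = f x ^ 2 - D x := by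
    intro x
    have eA : ∀ i, pd (Fin.castSucc i) (A i) x
        = x N * (pd N (pd N (pd (Fin.castSucc i) u)) x * pd (Fin.castSucc i) u x
          + pd N (pd N u) x * pd (Fin.castSucc i) (pd (Fin.castSucc i) u) x) := by
      intro i
      rw [pd_weight_mul_mul hX (s2 _ _) (s1 _), dX, pd_comm (s1 N) (Fin.castSucc i) N,
        pd_comm hu (Fin.castSucc i) N]
      ring
    have eB : ∀ i j, pd (Fin.castSucc i) (B i j) x
        = x N * x N * (pd (Fin.castSucc i) (pd (Fin.castSucc j) (pd (Fin.castSucc j) u)) x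
            * pd (Fin.castSucc i) u x
          + pd (Fin.castSucc j) (pd (Fin.castSucc j) u) x
            * pd (Fin.castSucc i) (pd (Fin.castSucc i) u) x) := by
      intro i j
      rw [pd_weight_mul_mul hX2 (s2 _ _) (s1 _), dX2]
      ring
    have eC : ∀ i j, pd (Fin.castSucc j) (C i j) x
        = x N * x N * (pd (Fin.castSucc i) (pd (Fin.castSucc j) (pd (Fin.castSucc j) u)) x
            * pd (Fin.castSucc i) u x
          + (pd (Fin.castSucc i) (pd (Fin.castSucc j) u) x) ^ 2) := by
      intro i j
      rw [pd_weight_mul_mul hX2 (s2 _ _) (s1 _), dX2,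
        pd_comm (s1 (Fin.castSucc j)) (Fin.castSucc j) (Fin.castSucc i),
        pd_comm hu (Fin.castSucc j) (Fin.castSucc i)]
      ring
    have eR : ∀ i, pd N (R i) x
        = 2 * (pd N (pd (Fin.castSucc i) u) x * pd (Fin.castSucc i) u x) := by
      intro i
      rw [pd_mul (s1 _) (s1 _)]
      ring
    have eS : ∀ i, pd N (S i) x
        = pd N (pd (Fin.castSucc i) u) x * pd (Fin.castSucc i) u x
          + x N * (pd N (pd N (pd (Fin.castSucc i) u)) x * pd (Fin.castSucc i) u x
            + (pd N (pd (Fin.castSucc i) u) x) ^ 2) := by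
      intro i
      rw [pd_weight_mul_mul hX (s2 _ _) (s1 _), dN]
      ring
    have eD : D x = 2 * x N * pd N (pd N u) x
          * ∑ i : Fin n, pd (Fin.castSucc i) (pd (Fin.castSucc i) u) x
        + (x N) ^ 2 * ((∑ i : Fin n, pd (Fin.castSucc i) (pd (Fin.castSucc i) u) x)
            * ∑ j : Fin n, pd (Fin.castSucc j) (pd (Fin.castSucc j) u) x)
        - (x N) ^ 2 * ∑ i : Fin n, ∑ j : Fin n,
            (pd (Fin.castSucc i) (pd (Fin.castSucc j) u) x) ^ 2
        - 2 * x N * ∑ i : Fin n, (pd N (pd (Fin.castSucc i) u) x) ^ 2 := by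
      rw [Finset.sum_mul_sum]
      simp only [D, eA, eB, eC, eR, eS, Finset.mul_sum, ← Finset.sum_add_distrib,
        ← Finset.sum_sub_distrib]
      refine Finset.sum_congr rfl fun i _ => ?_
      have hsum : ∑ j : Fin n, (x N * x N
            * (pd (Fin.castSucc i) (pd (Fin.castSucc j) (pd (Fin.castSucc j) u)) x
                * pd (Fin.castSucc i) u x
              + pd (Fin.castSucc j) (pd (Fin.castSucc j) u) x
                * pd (Fin.castSucc i) (pd (Fin.castSucc i) u) x)
          - x N * x N
            * (pd (Fin.castSucc i) (pd (Fin.castSucc j) (pd (Fin.castSucc j) u)) x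
                * pd (Fin.castSucc i) u x
              + (pd (Fin.castSucc i) (pd (Fin.castSucc j) u) x) ^ 2))
          = ∑ j : Fin n, (x N) ^ 2 * (pd (Fin.castSucc i) (pd (Fin.castSucc i) u) x
                * pd (Fin.castSucc j) (pd (Fin.castSucc j) u) x)
            - ∑ j : Fin n, (x N) ^ 2 * (pd (Fin.castSucc i) (pd (Fin.castSucc j) u) x) ^ 2 := by
        rw [← Finset.sum_sub_distrib]
        exact Finset.sum_congr rfl fun j _ => by ring
      rw [hsum]
      ring
    rw [eD, hf]
    ring
  have hfI : Integrable (fun x => f x ^ 2) := by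
    have hfc : Continuous f := by
      rw [show f = _ from funext hf]
      exact (s2 _ _).continuous.add (hX.continuous.mul
        (continuous_finsetSum _ fun i _ => (s2 _ _).continuous))
    refine (hfc.pow 2).integrable_of_hasCompactSupport (HasCompactSupport.intro hcs fun x hx => ?_)
    have hz : ∀ k l, pd k (pd l u) x = 0 := fun k l => image_eq_zero_of_notMem_tsupport fun h =>
      hx (tsupport_fderiv_apply_subset ℝ _ (tsupport_fderiv_apply_subset ℝ _ h))
    simp [hf, hz]
  have iA := fun i => (integrable_pd (sA i) (cA i) (Fin.castSucc i)).integrableOn (s := H)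
  have iB := fun i j => (integrable_pd (sB i j) (cB i j) (Fin.castSucc i)).integrableOn (s := H)
  have iC := fun i j => (integrable_pd (sC i j) (cC i j) (Fin.castSucc j)).integrableOn (s := H)
  have iR := fun i => (integrable_pd (sR i) (cR i) N).integrableOn (s := H)
  have iS := fun i => (integrable_pd (sS i) (cS i) N).integrableOn (s := H)
  have iBC' : ∀ i j, IntegrableOn (fun x =>
      pd (Fin.castSucc i) (B i j) x - pd (Fin.castSucc j) (C i j) x) H := fun i j =>
    (iB i j).sub (iC i j)
  have iBC : ∀ i, IntegrableOn (fun x =>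
      ∑ j, (pd (Fin.castSucc i) (B i j) x - pd (Fin.castSucc j) (C i j) x)) H := fun i =>
    integrable_finsetSum _ fun j _ => iBC' i j
  have iABC : ∀ i, IntegrableOn (fun x => 2 * pd (Fin.castSucc i) (A i) x
      + ∑ j, (pd (Fin.castSucc i) (B i j) x - pd (Fin.castSucc j) (C i j) x)) H := fun i =>
    ((iA i).const_mul 2).add (iBC i)
  have iRS : ∀ i, IntegrableOn (fun x => pd N (R i) x - 2 * pd N (S i) x) H := fun i =>
    (iR i).sub ((iS i).const_mul 2)
  have iABCRS : ∀ i, IntegrableOn (fun x => 2 * pd (Fin.castSucc i) (A i) x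
      + ∑ j, (pd (Fin.castSucc i) (B i j) x - pd (Fin.castSucc j) (C i j) x)
      + (pd N (R i) x - 2 * pd N (S i) x)) H := fun i => (iABC i).add (iRS i)
  have iD : IntegrableOn D H := integrable_finsetSum _ fun i _ => iABCRS i
  have hgrad : ∀ (i : Fin n) (x : Fin n → ℝ), R i (Fin.snoc x 0) = pd i g x ^ 2 := by
    intro i x
    rw [show g = _ from funext hg, pd_comp_snoc_zero hu]
    simp only [R]
    ring
  have hDint : ∫ x in H, D x = -∫ x' : Fin n → ℝ, ∑ i : Fin n, (pd i g x') ^ 2 := by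
    simp only [D]
    rw [integral_finsetSum _ fun i _ => iABCRS i,
      integral_finsetSum _ fun i _ => ?_, ← Finset.sum_neg_distrib]
    · refine Finset.sum_congr rfl fun i _ => ?_
      rw [integral_add (iABC i) (iRS i), integral_add ((iA i).const_mul 2) (iBC i),
        integral_finsetSum _ fun j _ => iBC' i j,
        integral_sub (iR i) ((iS i).const_mul 2), integral_const_mul, integral_const_mul,
        setIntegral_halfSpace_pd_castSucc (sA i) (cA i),
        setIntegral_halfSpace_pd_last (sR i) (cR i), setIntegral_halfSpace_pd_last (sS i) (cS i),
        Finset.sum_eq_zero fun j _ => by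
          rw [integral_sub (iB i j) (iC i j), setIntegral_halfSpace_pd_castSucc (sB i j) (cB i j),
            setIntegral_halfSpace_pd_castSucc (sC i j) (cC i j), sub_zero]]
      simp [hgrad, S, hN]
    · simp only [← hgrad]
      exact ((sR i).continuous.comp
        (isClosedEmbedding_snoc_left 0).continuous).integrable_of_hasCompactSupport
          ((cR i).comp_isClosedEmbedding (isClosedEmbedding_snoc_left 0))
  simp only [point]
  rw [integral_sub hfI.integrableOn iD, hDint, sub_neg_eq_add]
end
end
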